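/- Let k be a field and x₁, x₂, x₃ ∈ k. Consider the 6×6 block matrix G = [[0, A],[−Aᵀ, 0]] where A is the 3×3 matrix with rows (0, x₁, x₂), (x₁, 0, x₃), (x₂, x₃, 0). Then det(G) = 4·x₁²·x₂²·x₃². Consequently, if char(k) = 2 then det(G) = 0 for all x₁, x₂, x₃, while if char(k) ≠ 2 then det(G) ≠ 0 whenever x₁x₂x₃ ≠ 0. -/

import Mathlib

open Matrix

theorem det_blockMatrix {R : Type*} [CommRing R] (x₁ x₂ x₃ : R) :
    (!![(0 : R), 0, 0, 0, x₁, x₂;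
        0, 0, 0, x₁, 0, x₃;
        0, 0, 0, x₂, x₃, 0;
        0, -x₁, -x₂, 0, 0, 0;
        -x₁, 0, -x₃, 0, 0, 0;
        -x₂, -x₃, 0, 0, 0, 0]).det = 4 * x₁ ^ 2 * x₂ ^ 2 * x₃ ^ 2 := by
  simp [det_succ_row_zero, Fin.sum_univ_succ, Fin.succAbove]
  ring

theorem D4_block_det {k : Type*} [Field k] (x₁ x₂ x₃ : k) :
    (!![(0 : k), 0, 0, 0, x₁, x₂;
        0, 0, 0, x₁, 0, x₃;
        0, 0, 0, x₂, x₃, 0;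
        0, -x₁, -x₂, 0, 0, 0;
        -x₁, 0, -x₃, 0, 0, 0;
        -x₂, -x₃, 0, 0, 0, 0]).det = 4 * x₁ ^ 2 * x₂ ^ 2 * x₃ ^ 2 ∧
    (ringChar k = 2 →
      (!![(0 : k), 0, 0, 0, x₁, x₂;
          0, 0, 0, x₁, 0, x₃;
          0, 0, 0, x₂, x₃, 0;
          0, -x₁, -x₂, 0, 0, 0;
          -x₁, 0, -x₃, 0, 0, 0;
          -x₂, -x₃, 0, 0, 0, 0]).det = 0) ∧
    (ringChar k ≠ 2 → x₁ * x₂ * x₃ ≠ 0 →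
      (!![(0 : k), 0, 0, 0, x₁, x₂;
          0, 0, 0, x₁, 0, x₃;
          0, 0, 0, x₂, x₃, 0;
          0, -x₁, -x₂, 0, 0, 0;
          -x₁, 0, -x₃, 0, 0, 0;
          -x₂, -x₃, 0, 0, 0, 0]).det ≠ 0) := by
  rw [det_blockMatrix]
  refine ⟨rfl, fun h => ?_, fun h hx => ?_⟩
  · have h2 : (2 : k) = 0 := by
      simpa [h] using ringChar.Nat.cast_ringChar (R := k)
    linear_combination 2 * x₁ ^ 2 * x₂ ^ 2 * x₃ ^ 2 * h2
  · have h2 : (2 : k) ≠ 0 := Ring.two_ne_zero h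
    convert pow_ne_zero 2 (mul_ne_zero h2 hx) using 1
    ring
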